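/- Let (X,σ) be an infinite minimal cascade with X compact Hausdorff. The following are equivalent: (1) X is second countable and there exists a circular order on X whose interval topology equals the topology of X and for which σ is c-order preserving; (2) there exist a homeomorphism ψ : ℝ/ℤ → ℝ/ℤ with no periodic points and a topological embedding i : X → ℝ/ℤ such that i ∘ σ = ψ ∘ i. -/

import Mathlib

/-- A circular order on a set `X`: a ternary relation satisfying cyclicity,
asymmetry, transitivity and totality. -/
structure CircularOrderRel (X : Type*) where
  rel : X → X → X → Prop
  cyclic : ∀ a b c, rel a b c → rel b c a
  asymm : ∀ a b c, rel a b c → ¬ rel a c b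
  trans : ∀ a b c d, rel a b c → rel a c d → rel a b d
  total : ∀ a b c : X, a ≠ b → b ≠ c → a ≠ c → rel a b c ∨ rel a c b

/-- The interval topology of a ternary (circular order) relation: the topology
generated by the open intervals `(a,b) = {x | [a,x,b]}` for distinct `a, b`. -/
def intervalTopology {X : Type*} (r : X → X → X → Prop) : TopologicalSpace X :=
  TopologicalSpace.generateFrom {s | ∃ a b : X, a ≠ b ∧ s = {x | r a x b}}

/-- The closed interval `[a,c]` of a circular order relation. -/
def closedArc {X : Type*} (r : X → X → X → Prop) (a c : X) : Set X :=
  {a, c} ∪ {x | r a x c}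

/-- A map between circularly ordered sets is c-order preserving (COP). -/
def IsCOP {X Y : Type*} (r : X → X → X → Prop) (r' : Y → Y → Y → Prop)
    (f : X → Y) : Prop :=
  (∀ a b c : X, r a b c → f a ≠ f b → f b ≠ f c → f a ≠ f c → r' (f a) (f b) (f c)) ∧
  (∀ a c : X, f a = f c →
    (∀ x ∈ closedArc r a c, f x = f a) ∨ (∀ x ∈ closedArc r c a, f x = f a))

/-- A sequence of real valued functions is independent. -/
def IsIndepSeq {X : Type*} (f : ℕ → X → ℝ) : Prop :=
  ∃ a b : ℝ, a < b ∧ ∀ P M : Finset ℕ, Disjoint P M →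
    ((⋂ n ∈ P, {x | f n x < a}) ∩ (⋂ n ∈ M, {x | b < f n x})).Nonempty

/-- The standard circular order on `{0, 1, …, n-1}` (integers mod `n`). -/
def cyclicFin {n : ℕ} (i j k : Fin n) : Prop :=
  (i < j ∧ j < k) ∨ (j < k ∧ k < i) ∨ (k < i ∧ i < j)

/-- A tuple `(x 0, …, x (n-1))` is a cycle in a circularly ordered set. -/
def IsCycle {X : Type*} (r : X → X → X → Prop) {n : ℕ} (x : Fin n → X) : Prop :=
  (∀ i j k : Fin n, cyclicFin i j k → x i ≠ x j → x j ≠ x k → x i ≠ x k →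
      r (x i) (x j) (x k)) ∧
  (∀ i k : Fin n, x i = x k →
    (∀ j : Fin n, (j = i ∨ j = k ∨ cyclicFin i j k) → x j = x i) ∨
    (∀ j : Fin n, (j = i ∨ j = k ∨ cyclicFin k j i) → x j = x i))

/-- `f` has cyclic variation at most `v`. -/
def CyclicVariationLe {X : Type*} (r : X → X → X → Prop) (f : X → ℝ) (v : ℝ) : Prop :=
  ∀ (n : ℕ) (x : Fin (n + 1) → X), IsCycle r x →
    ∑ i : Fin (n + 1), |f (x i) - f (x (i + 1))| ≤ v

/-- The cyclic ordering of three points of a linear order. -/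
def CycLT {α : Type*} [LT α] (a b c : α) : Prop :=
  (a < b ∧ b < c) ∨ (b < c ∧ c < a) ∨ (c < a ∧ a < b)

theorem cycLT_comp_iff {α β : Type*} [LinearOrder α] [LinearOrder β] {g : α → β}
    (hg : StrictMono g) {a b c : α} : CycLT (g a) (g b) (g c) ↔ CycLT a b c := by
  simp only [CycLT, hg.lt_iff_lt]

/-- The circular order pulled back from a linear order along an injective map. -/
def CircularOrderRel.ofInjective {X α : Type*} [LinearOrder α] (g : X → α)
    (hg : Function.Injective g) : CircularOrderRel X where
  rel a b c := CycLT (g a) (g b) (g c)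
  cyclic a b c := by unfold CycLT; grind
  asymm a b c := by unfold CycLT; grind
  trans a b c d := by unfold CycLT; grind
  total a b c hab hbc hac := by
    have h1 := hg.ne hab
    have h2 := hg.ne hbc
    have h3 := hg.ne hac
    unfold CycLT; grind

/-- The interval topology of an infinite circularly ordered set is Hausdorff. -/
theorem CircularOrderRel.t2Space_intervalTopology {X : Type*} [Infinite X]
    (R : CircularOrderRel X) : @T2Space X (intervalTopology R.rel) := by
  let _ : TopologicalSpace X := intervalTopology R.rel
  have hopen : ∀ a b : X, a ≠ b → IsOpen {x | R.rel a x b} := fun a b hab =>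
    TopologicalSpace.isOpen_generateFrom_of_mem ⟨a, b, hab, rfl⟩
  have hcyc := R.cyclic
  have hasymm := R.asymm
  have htrans := R.trans
  have htotal := R.total
  have hne1 : ∀ a b c, R.rel a b c → a ≠ b ∧ b ≠ c ∧ a ≠ c := by
    intro a b c h
    refine ⟨?_, ?_, ?_⟩ <;> rintro rfl <;> grind
  have key : ∀ a b c d : X, R.rel a c b → R.rel b d a →
      ∃ u v : Set X, IsOpen u ∧ IsOpen v ∧ a ∈ u ∧ b ∈ v ∧ Disjoint u v := by
    intro a b c d hc hd
    have hcd : c ≠ d := by rintro rfl; grind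
    refine ⟨_, _, hopen d c hcd.symm, hopen c d hcd, ?_, ?_, ?_⟩
    · show R.rel d a c; grind
    · show R.rel c b d; grind
    · rw [Set.disjoint_left]
      intro x hx hx'
      simp only [Set.mem_ofPred_eq] at hx hx'
      grind
  have key2 : ∀ a b d : X, (∀ c, ¬ R.rel a c b) → R.rel b d a →
      ∃ u v : Set X, IsOpen u ∧ IsOpen v ∧ a ∈ u ∧ b ∈ v ∧ Disjoint u v := by
    intro a b d hc hd
    have hd' := hne1 _ _ _ hd
    refine ⟨_, _, hopen d b hd'.1.symm, hopen a d hd'.2.1.symm, ?_, ?_, ?_⟩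
    · show R.rel d a b; grind
    · show R.rel a b d; grind
    · rw [Set.disjoint_left]
      intro x hx hx'
      simp only [Set.mem_ofPred_eq] at hx hx'
      have := hc x
      have := hne1 _ _ _ hx
      have := hne1 _ _ _ hx'
      grind
  refine ⟨fun a b hab => ?_⟩
  by_cases h1 : ∃ c, R.rel a c b
  · obtain ⟨c, hc⟩ := h1
    by_cases h2 : ∃ d, R.rel b d a
    · obtain ⟨d, hd⟩ := h2
      exact key a b c d hc hd
    · push Not at h2
      obtain ⟨u, v, hu, hv, hbu, hav, h⟩ := key2 b a c h2 hc
      exact ⟨v, u, hv, hu, hav, hbu, h.symm⟩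
  · push Not at h1
    obtain ⟨d, hd⟩ := (Set.toFinite {a, b}).exists_notMem
    simp only [Set.mem_insert_iff, Set.mem_singleton_iff, not_or] at hd
    have := h1 d
    exact key2 a b d h1 (by grind)

/-- The representative in `[0, 1)` of a point of the unit circle. -/
noncomputable def circleRep (a : AddCircle (1 : ℝ)) : ℝ :=
  haveI : Fact ((0 : ℝ) < 1) := ⟨one_pos⟩
  (AddCircle.equivIco 1 0 a : ℝ)

theorem coe_circleRep (a : AddCircle (1 : ℝ)) : (circleRep a : AddCircle (1 : ℝ)) = a := by
  have : Fact ((0 : ℝ) < 1) := ⟨one_pos⟩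
  exact AddCircle.coe_equivIco

theorem circleRep_nonneg (a : AddCircle (1 : ℝ)) : 0 ≤ circleRep a := by
  have : Fact ((0 : ℝ) < 1) := ⟨one_pos⟩
  exact (AddCircle.equivIco 1 0 a).2.1

theorem circleRep_lt_one (a : AddCircle (1 : ℝ)) : circleRep a < 1 := by
  have : Fact ((0 : ℝ) < 1) := ⟨one_pos⟩
  simpa [circleRep] using (AddCircle.equivIco (1 : ℝ) 0 a).2.2

theorem circleRep_injective : Function.Injective circleRep := fun a b h => by
  rw [← coe_circleRep a, h, coe_circleRep]

theorem circleRep_coe {x : ℝ} (h0 : 0 ≤ x) (h1 : x < 1) :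
    circleRep (x : AddCircle (1 : ℝ)) = x := by
  have : Fact ((0 : ℝ) < 1) := ⟨one_pos⟩
  change (AddCircle.equivIco 1 0 (x : AddCircle (1 : ℝ)) : ℝ) = x
  rw [AddCircle.equivIco_coe_eq (p := (1 : ℝ)) (a := 0) (x := x) ⟨h0, by simpa using h1⟩]

theorem coe_eq_coe_iff_exists_int {x y : ℝ} :
    (x : AddCircle (1 : ℝ)) = y ↔ ∃ n : ℤ, y = x + n := by
  rw [← sub_eq_zero, ← AddCircle.coe_sub, AddCircle.coe_eq_zero_iff]
  constructor
  · rintro ⟨n, hn⟩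
    refine ⟨-n, ?_⟩
    simp at hn
    push_cast
    linarith
  · rintro ⟨n, hn⟩
    refine ⟨-n, ?_⟩
    simp
    linarith

/-- Three points of the circle are cyclically ordered exactly when they have increasing lifts
within one period. -/
theorem cycLT_circleRep_iff (a b c : AddCircle (1 : ℝ)) :
    CycLT (circleRep a) (circleRep b) (circleRep c) ↔
      ∃ x y z : ℝ, x < y ∧ y < z ∧ z < x + 1 ∧
        (x : AddCircle (1 : ℝ)) = a ∧ (y : AddCircle (1 : ℝ)) = b ∧
        (z : AddCircle (1 : ℝ)) = c := by
  have ha := circleRep_nonneg a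
  have hb := circleRep_nonneg b
  have hc := circleRep_nonneg c
  have ha' := circleRep_lt_one a
  have hb' := circleRep_lt_one b
  have hc' := circleRep_lt_one c
  have hp : ∀ x : AddCircle (1 : ℝ), ((circleRep x + 1 : ℝ) : AddCircle (1 : ℝ)) = x := by
    intro x
    rw [AddCircle.coe_add_period, coe_circleRep]
  constructor
  · rintro (⟨h1, h2⟩ | ⟨h1, h2⟩ | ⟨h1, h2⟩)
    · exact ⟨_, _, _, h1, h2, by linarith, coe_circleRep a, coe_circleRep b, coe_circleRep c⟩
    · exact ⟨circleRep a, circleRep b + 1, circleRep c + 1, by linarith, by linarith,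
        by linarith, coe_circleRep a, hp b, hp c⟩
    · exact ⟨circleRep a, circleRep b, circleRep c + 1, by linarith, by linarith,
        by linarith, coe_circleRep a, coe_circleRep b, hp c⟩
  · rintro ⟨x, y, z, hxy, hyz, hzx, hxa, hyb, hzc⟩
    obtain ⟨n, hn⟩ := coe_eq_coe_iff_exists_int.1 (hxa.trans (coe_circleRep a).symm)
    obtain ⟨m, hm⟩ := coe_eq_coe_iff_exists_int.1 (hyb.trans (coe_circleRep b).symm)
    obtain ⟨k, hk⟩ := coe_eq_coe_iff_exists_int.1 (hzc.trans (coe_circleRep c).symm)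
    have e1 : m = n ∨ m = n - 1 := by
      have h1 : (m : ℝ) < n + 1 := by linarith
      have h2 : (n : ℝ) - 2 < m := by linarith
      have h1' : m < n + 1 := by exact_mod_cast h1
      have h2' : n - 2 < m := by exact_mod_cast h2
      omega
    have e2 : k = n ∨ k = n - 1 := by
      have h1 : (k : ℝ) < n + 1 := by linarith
      have h2 : (n : ℝ) - 2 < k := by linarith
      have h1' : k < n + 1 := by exact_mod_cast h1
      have h2' : n - 2 < k := by exact_mod_cast h2
      omega
    unfold CycLT
    rcases e1 with rfl | rfl <;> rcases e2 with rfl | rfl <;> push_cast at hm hk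
    · left; constructor <;> linarith
    · right; right; constructor <;> linarith
    · linarith
    · right; left; constructor <;> linarith

theorem isOpen_circle_arc (a b : AddCircle (1 : ℝ)) :
    IsOpen {y | CycLT (circleRep a) (circleRep y) (circleRep b)} := by
  have hom : ∀ u v : ℝ, IsOpen ((fun x : ℝ => (x : AddCircle (1 : ℝ))) '' Set.Ioo u v) :=
    fun u v => QuotientAddGroup.isOpenMap_coe _ isOpen_Ioo
  rcases lt_trichotomy (circleRep a) (circleRep b) with h | h | h
  · convert! hom (circleRep a) (circleRep b) using 1
    ext y
    constructor
    · intro hy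
      refine ⟨circleRep y, ?_, coe_circleRep y⟩
      simp only [Set.mem_ofPred_eq, CycLT, Set.mem_Ioo] at hy ⊢
      grind
    · rintro ⟨x, hx, rfl⟩
      have h1 := circleRep_nonneg a
      have h2 := circleRep_lt_one b
      show CycLT _ _ _
      dsimp only
      rw [circleRep_coe (by linarith [hx.1]) (by linarith [hx.2])]
      exact Or.inl ⟨hx.1, hx.2⟩
  · convert isOpen_empty
    ext y
    simp only [Set.mem_ofPred_eq, CycLT, Set.mem_empty_iff_false, iff_false]
    grind
  · convert! hom (circleRep a) (circleRep b + 1) using 1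
    ext y
    have h0 := circleRep_nonneg y
    have h1 := circleRep_lt_one y
    have hb := circleRep_nonneg b
    have hb' := circleRep_lt_one b
    have ha := circleRep_nonneg a
    have ha' := circleRep_lt_one a
    constructor
    · intro hy
      by_cases hay : circleRep a < circleRep y
      · exact ⟨circleRep y, ⟨hay, by linarith⟩, coe_circleRep y⟩
      · refine ⟨circleRep y + 1, ⟨by linarith, ?_⟩, ?_⟩
        · simp only [Set.mem_ofPred_eq, CycLT] at hy
          have : circleRep y < circleRep b := by grind
          linarith
        · simp only
          rw [AddCircle.coe_add_period, coe_circleRep]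
    · rintro ⟨x, hx, rfl⟩
      show CycLT _ _ _
      dsimp only at h0 h1 ⊢
      by_cases hx1 : x < 1
      · rw [circleRep_coe (by linarith [hx.1]) hx1]
        exact Or.inr (Or.inr ⟨h, hx.1⟩)
      · have : (x : AddCircle (1 : ℝ)) = ((x - 1 : ℝ) : AddCircle (1 : ℝ)) := by
          rw [← AddCircle.coe_add_period (1 : ℝ) (x - 1), sub_add_cancel]
        rw [this, circleRep_coe (by linarith) (by linarith [hx.2])]
        exact Or.inr (Or.inl ⟨by linarith [hx.2], h⟩)

/-- On a compact space, the topology induced by an embedding in the circle is the interval topology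
of the induced circular order. -/
theorem eq_intervalTopology_of_continuous_injective {X : Type*} [tX : TopologicalSpace X]
    [CompactSpace X] [Infinite X] {i : X → AddCircle (1 : ℝ)} (hi : Continuous i)
    (hinj : Function.Injective i) :
    tX = intervalTopology
      (CircularOrderRel.ofInjective (circleRep ∘ i) (circleRep_injective.comp hinj)).rel := by
  set R := CircularOrderRel.ofInjective (circleRep ∘ i) (circleRep_injective.comp hinj) with hR
  have hle : tX ≤ intervalTopology R.rel := by
    refine le_generateFrom ?_
    rintro s ⟨a, b, -, rfl⟩
    exact (isOpen_circle_arc (i a) (i b)).preimage hi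
  have ht2 := R.t2Space_intervalTopology
  refine le_antisymm hle ?_
  have hc : @Continuous X X tX (intervalTopology R.rel) id := continuous_id_iff_le.2 hle
  have hcl := @Continuous.isClosedEmbedding X X tX (intervalTopology R.rel) _ ht2 id hc
    Function.injective_id
  have := @Topology.IsInducing.eq_induced X X tX (intervalTopology R.rel) id
    (@Topology.IsEmbedding.isInducing X X id tX (intervalTopology R.rel)
      (@Topology.IsClosedEmbedding.isEmbedding X X id tX (intervalTopology R.rel) hcl))
  exact (this.trans (@induced_id X (intervalTopology R.rel))).ge

/-- A map to the circle is continuous if the preimages of open arcs are open. -/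
theorem continuous_of_isOpen_setOf_cycLT_circleRep {X : Type*} [TopologicalSpace X]
    {f : X → AddCircle (1 : ℝ)}
    (h : ∀ a b, a ≠ b → IsOpen {x | CycLT (circleRep a) (circleRep (f x)) (circleRep b)}) :
    Continuous f := by
  have : Fact ((0 : ℝ) < 1) := ⟨one_pos⟩
  have : Infinite (AddCircle (1 : ℝ)) :=
    Infinite.of_injective (fun x : Set.Ico (0 : ℝ) 1 => ((x : ℝ) : AddCircle (1 : ℝ)))
      fun x y hxy => Subtype.ext (by
        have := congrArg circleRep hxy
        rwa [circleRep_coe x.2.1 x.2.2, circleRep_coe y.2.1 y.2.2] at this)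
  have ht := eq_intervalTopology_of_continuous_injective
    (continuous_id (X := AddCircle (1 : ℝ))) Function.injective_id
  have hc : @Continuous _ _ _ (intervalTopology (CircularOrderRel.ofInjective
      (circleRep ∘ (id : AddCircle (1 : ℝ) → _))
      (circleRep_injective.comp Function.injective_id)).rel) f := by
    refine continuous_generateFrom_iff.2 ?_
    rintro s ⟨a, b, hab, rfl⟩
    exact h a b hab
  rwa [← ht] at hc

theorem continuous_of_cycLT_circleRep_iff {ψ : AddCircle (1 : ℝ) ≃ AddCircle (1 : ℝ)}
    (h : ∀ a b c, CycLT (circleRep (ψ a)) (circleRep (ψ b)) (circleRep (ψ c)) ↔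
      CycLT (circleRep a) (circleRep b) (circleRep c)) : Continuous ψ := by
  refine continuous_of_isOpen_setOf_cycLT_circleRep fun a b _ => ?_
  convert! isOpen_circle_arc (ψ.symm a) (ψ.symm b) using 1
  ext y
  rw [Set.mem_ofPred_eq, Set.mem_ofPred_eq, ← h (ψ.symm a), ψ.apply_symm_apply,
    ψ.apply_symm_apply]

/-- A homeomorphism of the circle without fixed points preserves the cyclic order. -/
theorem cycLT_circleRep_of_forall_ne (ψ : AddCircle (1 : ℝ) ≃ₜ AddCircle (1 : ℝ))
    (hψ : ∀ y, ψ y ≠ y) {a b c : AddCircle (1 : ℝ)}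
    (h : CycLT (circleRep a) (circleRep b) (circleRep c)) :
    CycLT (circleRep (ψ a)) (circleRep (ψ b)) (circleRep (ψ c)) := by
  have : Fact ((0 : ℝ) < 1) := ⟨one_pos⟩
  have cov : IsCoveringMap (fun x : ℝ => (x : AddCircle (1 : ℝ))) :=
    AddCircle.isCoveringMap_coe 1
  have hcoe : Continuous (fun x : ℝ => (x : AddCircle (1 : ℝ))) := cov.continuous
  obtain ⟨F, ⟨hF0, hF⟩, -⟩ := cov.existsUnique_continuousMap_lifts
    ⟨fun x : ℝ => ψ (x : AddCircle (1 : ℝ)), ψ.continuous.comp hcoe⟩ 0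
    (circleRep (ψ ((0 : ℝ) : AddCircle (1 : ℝ)))) (coe_circleRep _)
  have hF' : ∀ x, (F x : AddCircle (1 : ℝ)) = ψ x := fun x => congrFun hF x
  obtain ⟨G, ⟨hG0, hG⟩, -⟩ := cov.existsUnique_continuousMap_lifts
    ⟨fun x : ℝ => ψ.symm (x : AddCircle (1 : ℝ)), ψ.symm.continuous.comp hcoe⟩ (F 0) 0
    (by simp [hF'])
  have hG' : ∀ x, (G x : AddCircle (1 : ℝ)) = ψ.symm x := fun x => congrFun hG x
  have hGF : ∀ x, G (F x) = x := by
    have huniq := (cov.existsUnique_continuousMap_lifts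
      ⟨fun x : ℝ => (x : AddCircle (1 : ℝ)), hcoe⟩ 0 0 rfl).unique
      (y₁ := G.comp F) (y₂ := ContinuousMap.id ℝ)
      ⟨hG0, by ext x; simp [hG', hF']⟩ ⟨rfl, rfl⟩
    exact fun x => DFunLike.congr_fun huniq x
  have hinj : Function.Injective F := Function.LeftInverse.injective hGF
  have hmono : StrictMono F := by
    refine (F.continuous.strictMono_of_inj hinj).resolve_right fun hanti => ?_
    have hcont : Continuous fun x => F x - x := F.continuous.sub continuous_id
    obtain ⟨x, hx⟩ : (0 : ℝ) ∈ Set.range fun x => F x - x := by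
      rcases le_total 0 (F 0) with h0 | h0
      · refine mem_range_of_exists_le_of_exists_ge hcont ⟨F 0, ?_⟩ ⟨0, by simpa using h0⟩
        have := hanti.antitone h0
        linarith
      · refine mem_range_of_exists_le_of_exists_ge hcont ⟨0, by simpa using h0⟩ ⟨F 0, ?_⟩
        have := hanti.antitone h0
        linarith
    apply hψ x
    rw [← hF']
    congr 1
    simp only at hx
    linarith
  rw [cycLT_circleRep_iff] at h ⊢
  obtain ⟨x, y, z, hxy, hyz, hzx, rfl, rfl, rfl⟩ := h
  refine ⟨F x, F y, F z, hmono hxy, hmono hyz, ?_, hF' x, hF' y, hF' z⟩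
  by_contra! hle
  obtain ⟨w, hw, hw'⟩ : F x + 1 ∈ F '' Set.Icc x z :=
    intermediate_value_Icc (hxy.trans hyz).le F.continuous.continuousOn ⟨by linarith, hle⟩
  have heq : ψ w = ψ x := by
    rw [← hF', ← hF', hw', AddCircle.coe_add_period]
  obtain ⟨n, hn⟩ := coe_eq_coe_iff_exists_int.1 (ψ.injective heq).symm
  have hn0 : n ≠ 0 := by
    rintro rfl
    simp only [Int.cast_zero, add_zero] at hn
    rw [hn] at hw'
    linarith
  have h1 : (0 : ℝ) ≤ n := by linarith [hw.1]
  have h2 : (n : ℝ) < 1 := by linarith [hw.2]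
  have h1' : 0 ≤ n := by exact_mod_cast h1
  have h2' : n < 1 := by exact_mod_cast h2
  omega

/-- A linear order with least element and no greatest element, which has a countable order-dense
subset and in which nonempty bounded sets have suprema, is isomorphic to `[0, 1)`. -/
theorem exists_strictMono_range_eq_Ico {Z : Type*} [LinearOrder Z] [OrderBot Z] [NoMaxOrder Z]
    {D : Set Z} (hD : D.Countable) (hdense : ∀ a b : Z, a < b → ∃ d ∈ D, a < d ∧ d < b)
    (hsup : ∀ S : Set Z, S.Nonempty → BddAbove S → ∃ x, IsLUB S x) :
    ∃ h : Z → ℝ, StrictMono h ∧ Set.range h = Set.Ico 0 1 := by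
  have hbtw : ∀ a b : Z, a < b → ∃ d : ↥(D \ {⊥}), a < d ∧ (d : Z) < b := by
    intro a b hab
    obtain ⟨d, hd, had, hdb⟩ := hdense a b hab
    exact ⟨⟨d, hd, (bot_le.trans_lt had).ne'⟩, had, hdb⟩
  have hpos : ∀ d : ↥(D \ {⊥}), ⊥ < (d : Z) := fun d => bot_lt_iff_ne_bot.2 d.2.2
  have : Countable ↥(D \ {⊥}) := (hD.mono Set.sdiff_subset).to_subtype
  have : DenselyOrdered ↥(D \ {⊥}) := ⟨fun a b hab =>
    let ⟨d, h⟩ := hbtw a b hab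
    ⟨d, h.1, h.2⟩⟩
  have : NoMinOrder ↥(D \ {⊥}) := ⟨fun a =>
    let ⟨d, h⟩ := hbtw ⊥ a (hpos a)
    ⟨d, h.2⟩⟩
  have : NoMaxOrder ↥(D \ {⊥}) := ⟨fun a =>
    let ⟨b, hb⟩ := exists_gt (a : Z)
    let ⟨d, h⟩ := hbtw a b hb
    ⟨d, h.1⟩⟩
  have : Nonempty ↥(D \ {⊥}) :=
    let ⟨b, hb⟩ := exists_gt (⊥ : Z)
    let ⟨d, _⟩ := hbtw ⊥ b hb
    ⟨d⟩
  have : Nonempty ↥(Set.Ioo (0 : ℚ) 1) := ⟨⟨1 / 2, by norm_num, by norm_num⟩⟩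
  obtain ⟨φ⟩ := Order.iso_of_countable_dense ↥(D \ {⊥}) ↥(Set.Ioo (0 : ℚ) 1)
  let q : ↥(D \ {⊥}) → ℝ := fun d => ((φ d : ℚ) : ℝ)
  have hq : StrictMono q := fun a b hab => by
    have : (φ a : ℚ) < φ b := φ.strictMono hab
    exact Rat.cast_lt.2 this
  have hq0 : ∀ d, 0 < q d := fun d => Rat.cast_pos.2 (φ d).2.1
  have hq1 : ∀ d, q d < 1 := fun d => by
    have : ((φ d : ℚ) : ℝ) < ((1 : ℚ) : ℝ) := Rat.cast_lt.2 (φ d).2.2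
    rwa [Rat.cast_one] at this
  have hqr : ∀ a b : ℝ, 0 ≤ a → a < b → b ≤ 1 → ∃ d, a < q d ∧ q d < b := by
    intro a b ha hab hb
    obtain ⟨r, hr1, hr2⟩ := exists_rat_btwn hab
    have h0 : (0 : ℚ) < r := by exact_mod_cast ha.trans_lt hr1
    have h1 : r < (1 : ℚ) := by exact_mod_cast hr2.trans_le hb
    refine ⟨φ.symm ⟨r, h0, h1⟩, ?_⟩
    simp only [q, OrderIso.apply_symm_apply]
    exact ⟨hr1, hr2⟩
  let A : Z → Set ℝ := fun z => insert 0 (q '' {d | (d : Z) < z})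
  let h : Z → ℝ := fun z => sSup (A z)
  have hne : ∀ z, (A z).Nonempty := fun z => ⟨0, Set.mem_insert _ _⟩
  have hbdd : ∀ z, BddAbove (A z) := by
    refine fun z => ⟨1, ?_⟩
    rintro _ (rfl | ⟨d, -, rfl⟩)
    · exact zero_le_one
    · exact (hq1 d).le
  have hle : ∀ (d : ↥(D \ {⊥})) (z : Z), (d : Z) < z → q d ≤ h z := fun d z hdz =>
    le_csSup (hbdd z) (Set.mem_insert_of_mem _ ⟨d, hdz, rfl⟩)
  have hge : ∀ (z : Z) (r : ℝ), 0 ≤ r → (∀ d : ↥(D \ {⊥}), (d : Z) < z → q d ≤ r) →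
      h z ≤ r := by
    intro z r hr hd
    refine csSup_le (hne z) ?_
    rintro _ (rfl | ⟨d, hdz, rfl⟩)
    · exact hr
    · exact hd d hdz
  have h0 : ∀ z, 0 ≤ h z := fun z => le_csSup (hbdd z) (Set.mem_insert _ _)
  have hle' : ∀ (d : ↥(D \ {⊥})) (z : Z), z ≤ (d : Z) → h z ≤ q d := fun d z hdz =>
    hge z _ (hq0 d).le fun d' hd' => hq.monotone (hd'.le.trans hdz)
  refine ⟨h, fun a b hab => ?_, Set.Subset.antisymm ?_ ?_⟩
  · obtain ⟨d, h1, h2⟩ := hbtw a b hab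
    obtain ⟨d', h1', h2'⟩ := hbtw d b h2
    exact (hle' d a h1.le).trans_lt ((hq h1').trans_le (hle d' b h2'))
  · rintro _ ⟨z, rfl⟩
    obtain ⟨b, hb⟩ := exists_gt z
    obtain ⟨d, hd, -⟩ := hbtw z b hb
    exact ⟨h0 z, (hle' d z hd.le).trans_lt (hq1 d)⟩
  · rintro r ⟨hr0, hr1⟩
    obtain ⟨e, he, -⟩ := hqr r 1 hr0 hr1 le_rfl
    obtain ⟨w, hw⟩ := hsup (insert ⊥ (Subtype.val '' {d : ↥(D \ {⊥}) | q d < r}))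
      ⟨⊥, Set.mem_insert _ _⟩ ⟨e, by
        rintro _ (rfl | ⟨d, hd, rfl⟩)
        · exact bot_le
        · exact (hq.lt_iff_lt.1 (lt_trans hd he)).le⟩
    refine ⟨w, le_antisymm (hge w r hr0 fun d hd => ?_) ?_⟩
    · obtain ⟨s, hs, hds⟩ := (lt_isLUB_iff hw).1 hd
      rcases hs with rfl | ⟨d', hd', rfl⟩
      · exact absurd hds not_lt_bot
      · exact (hq hds).le.trans (le_of_lt hd')
    · by_contra! hlt
      obtain ⟨d, hd1, hd2⟩ := hqr _ _ (h0 w) hlt hr1.le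
      obtain ⟨d', hd1', hd2'⟩ := hqr _ _ (hq0 d).le hd2 hr1.le
      have h1 : (d' : Z) ≤ w := hw.1 (Set.mem_insert_of_mem _ ⟨d', hd2', rfl⟩)
      have h2 : (d : Z) < d' := hq.lt_iff_lt.1 hd1'
      exact absurd (hle d w (h2.trans_le h1)) (not_le.2 hd1)

/-- A point has a successor in the cyclic order if some open arc starting at it is empty. -/
def HasCycSucc {X : Type*} [LT X] (x : X) : Prop :=
  ∃ y, y ≠ x ∧ ∀ w, ¬ CycLT x w y

/-- The linear order obtained by gluing a copy of `[0, ∞)` in each gap of the cyclic order. -/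
@[ext]
structure FilledGaps (X : Type*) [LT X] where
  /-- The last point of the original order below the given point. -/
  pt : X
  /-- The height in the gap above `pt`. -/
  ht : ℝ
  mem : ht = 0 ∨ (0 < ht ∧ HasCycSucc pt)

namespace FilledGaps

section LinearOrder

variable {X : Type*} [LinearOrder X]

noncomputable instance : LinearOrder (FilledGaps X) :=
  LinearOrder.lift' (fun z => toLex (z.pt, z.ht)) fun z w h => by
    have h' : (z.pt, z.ht) = (w.pt, w.ht) := h
    exact FilledGaps.ext (congrArg Prod.fst h') (congrArg Prod.snd h')

theorem lt_iff {z w : FilledGaps X} : z < w ↔ z.pt < w.pt ∨ (z.pt = w.pt ∧ z.ht < w.ht) :=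
  Prod.Lex.lt_iff (x := toLex (z.pt, z.ht)) (y := toLex (w.pt, w.ht))

theorem le_iff {z w : FilledGaps X} : z ≤ w ↔ z.pt < w.pt ∨ (z.pt = w.pt ∧ z.ht ≤ w.ht) :=
  Prod.Lex.le_iff (x := toLex (z.pt, z.ht)) (y := toLex (w.pt, w.ht))

theorem ht_nonneg (z : FilledGaps X) : 0 ≤ z.ht := by
  rcases z.mem with h | h
  · exact h.ge
  · exact h.1.le

theorem hasCycSucc {z : FilledGaps X} (h : 0 < z.ht) : HasCycSucc z.pt := by
  rcases z.mem with h' | h'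
  · exact absurd h' h.ne'
  · exact h'.2

theorem cycLT_iff {z w u : FilledGaps X} : CycLT z w u ↔
    CycLT z.pt w.pt u.pt ∨ (z.pt = w.pt ∧ w.pt ≠ u.pt ∧ z.ht < w.ht) ∨
    (w.pt = u.pt ∧ u.pt ≠ z.pt ∧ w.ht < u.ht) ∨ (u.pt = z.pt ∧ z.pt ≠ w.pt ∧ u.ht < z.ht) ∨
    (z.pt = w.pt ∧ w.pt = u.pt ∧ CycLT z.ht w.ht u.ht) := by
  simp only [CycLT, lt_iff]
  rcases lt_trichotomy z.pt w.pt with h1 | h1 | h1 <;>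
  rcases lt_trichotomy w.pt u.pt with h2 | h2 | h2 <;>
  rcases lt_trichotomy z.pt u.pt with h3 | h3 | h3 <;> grind

/-- The inclusion of the original order. -/
def of (x : X) : FilledGaps X := ⟨x, 0, Or.inl rfl⟩

/-- The action on the filled order of a bijection preserving the cyclic order. -/
def congr (σ : X ≃ X) (hσ : ∀ a b c, CycLT (σ a) (σ b) (σ c) ↔ CycLT a b c) :
    FilledGaps X ≃ FilledGaps X :=
  have hsucc : ∀ x, HasCycSucc (σ x) ↔ HasCycSucc x := fun x => by
    constructor
    · rintro ⟨y, hy, h⟩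
      refine ⟨σ.symm y, fun e => hy (by rw [← e, σ.apply_symm_apply]), fun w hw => h (σ w) ?_⟩
      rwa [← hσ, σ.apply_symm_apply] at hw
    · rintro ⟨y, hy, h⟩
      refine ⟨σ y, σ.injective.ne hy, fun w hw => h (σ.symm w) ?_⟩
      rwa [← hσ, σ.apply_symm_apply]
  { toFun := fun z => ⟨σ z.pt, z.ht, z.mem.imp_right fun h => ⟨h.1, (hsucc _).2 h.2⟩⟩
    invFun := fun z => ⟨σ.symm z.pt, z.ht, z.mem.imp_right fun h =>
      ⟨h.1, (hsucc _).1 (by rw [σ.apply_symm_apply]; exact h.2)⟩⟩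
    left_inv := fun z => by simp
    right_inv := fun z => by simp }

theorem cycLT_congr_iff (σ : X ≃ X) (hσ : ∀ a b c, CycLT (σ a) (σ b) (σ c) ↔ CycLT a b c)
    {z w u : FilledGaps X} : CycLT (congr σ hσ z) (congr σ hσ w) (congr σ hσ u) ↔ CycLT z w u := by
  simp only [cycLT_iff, congr, Equiv.coe_fn_mk, hσ, ne_eq, EmbeddingLike.apply_eq_iff_eq]

/-- The filled order is conditionally complete if the original order is. -/
theorem exists_isLUB (hX : ∀ S : Set X, S.Nonempty → BddAbove S → ∃ x, IsLUB S x)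
    {S : Set (FilledGaps X)} (hne : S.Nonempty) (hb : BddAbove S) : ∃ z, IsLUB S z := by
  obtain ⟨b, hb⟩ := hb
  have hpt : ∀ {z w : FilledGaps X}, z ≤ w → z.pt ≤ w.pt := fun h =>
    (le_iff.1 h).elim le_of_lt fun h => h.1.le
  obtain ⟨x, hx⟩ := hX (pt '' S) (hne.image _) ⟨b.pt, by
    rintro _ ⟨s, hs, rfl⟩
    exact hpt (hb hs)⟩
  have hxu : ∀ u ∈ upperBounds S, x ≤ u.pt := fun u hu => hx.2 (by
    rintro _ ⟨s, hs, rfl⟩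
    exact hpt (hu hs))
  have hxs : ∀ s ∈ S, s.pt ≤ x := fun s hs => hx.1 ⟨s, hs, rfl⟩
  by_cases hatt : ∃ s ∈ S, s.pt = x
  · obtain ⟨s₀, hs₀, rfl⟩ := hatt
    let T : Set ℝ := ht '' {s ∈ S | s.pt = s₀.pt}
    have hTne : T.Nonempty := ⟨s₀.ht, s₀, ⟨hs₀, rfl⟩, rfl⟩
    by_cases hT : BddAbove T
    · have hmem : sSup T = 0 ∨ (0 < sSup T ∧ HasCycSucc s₀.pt) := by
        rcases (s₀.ht_nonneg.trans (le_csSup hT ⟨s₀, ⟨hs₀, rfl⟩, rfl⟩)).eq_or_lt with h | h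
        · exact Or.inl h.symm
        · obtain ⟨_, ⟨s, ⟨-, hs⟩, rfl⟩, hlt⟩ := exists_lt_of_lt_csSup hTne h
          exact Or.inr ⟨h, hs ▸ hasCycSucc hlt⟩
      refine ⟨⟨s₀.pt, sSup T, hmem⟩, fun s hs => ?_, fun u hu => ?_⟩
      · rw [le_iff]
        rcases (hxs s hs).lt_or_eq with h | h
        · exact Or.inl h
        · exact Or.inr ⟨h, le_csSup hT ⟨s, ⟨hs, h⟩, rfl⟩⟩
      · rw [le_iff]
        rcases (hxu u hu).lt_or_eq with h | h
        · exact Or.inl h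
        · refine Or.inr ⟨h, csSup_le hTne ?_⟩
          rintro _ ⟨s, ⟨hs, hs'⟩, rfl⟩
          rcases le_iff.1 (hu hs) with h' | h'
          · exact absurd h' (by rw [hs', ← h]; exact lt_irrefl _)
          · exact h'.2
    · have hlt : ∀ u ∈ upperBounds S, s₀.pt < u.pt := fun u hu =>
        (hxu u hu).lt_of_ne fun h => hT ⟨u.ht, by
          rintro _ ⟨s, ⟨hs, hs'⟩, rfl⟩
          rcases le_iff.1 (hu hs) with h' | h'
          · exact absurd h' (by rw [hs', ← h]; exact lt_irrefl _)
          · exact h'.2⟩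
      have hsucc : HasCycSucc s₀.pt := by
        by_contra hns
        refine hT ⟨0, ?_⟩
        rintro _ ⟨s, ⟨-, hs⟩, rfl⟩
        by_contra! hpos
        exact hns (hs ▸ hasCycSucc hpos)
      obtain ⟨y, hy, hyw⟩ := hsucc
      have hb' := hlt b hb
      have hsy : s₀.pt < y := by
        have := hyw b.pt
        unfold CycLT at this
        grind
      refine ⟨of y, fun s hs => le_iff.2 (Or.inl ((hxs s hs).trans_lt hsy)), fun u hu => ?_⟩
      have hu' := hlt u hu
      have hyu : y ≤ u.pt := by
        have := hyw u.pt
        unfold CycLT at this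
        grind
      rw [le_iff]
      rcases hyu.lt_or_eq with h | h
      · exact Or.inl h
      · exact Or.inr ⟨h, u.ht_nonneg⟩
  · push Not at hatt
    refine ⟨of x, fun s hs => le_iff.2 (Or.inl ((hxs s hs).lt_of_ne (hatt s hs))),
      fun u hu => ?_⟩
    rw [le_iff]
    rcases (hxu u hu).lt_or_eq with h | h
    · exact Or.inl h
    · exact Or.inr ⟨h, u.ht_nonneg⟩

/-- An order-dense subset of the filled order. -/
theorem exists_countable_dense {D : Set X} (hD : D.Countable)
    (hdense : ∀ a w b, CycLT a w b → ∃ d ∈ D, CycLT a d b) (hsucc : ∀ x, HasCycSucc x → x ∈ D) :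
    ∃ E : Set (FilledGaps X), E.Countable ∧ ∀ a b : FilledGaps X, a < b → ∃ d ∈ E, a < d ∧ d < b := by
  refine ⟨(fun z => (z.pt, z.ht)) ⁻¹' (D ×ˢ Set.range ((↑) : ℚ → ℝ)),
    (hD.prod (Set.countable_range _)).preimage fun z w h =>
      FilledGaps.ext (congrArg Prod.fst h) (congrArg Prod.snd h), fun a b hab => ?_⟩
  rcases lt_iff.1 hab with h | ⟨h, hlt⟩
  · by_cases hs : HasCycSucc a.pt
    · obtain ⟨q, hq⟩ := exists_rat_gt a.ht
      exact ⟨⟨a.pt, q, Or.inr ⟨a.ht_nonneg.trans_lt hq, hs⟩⟩, ⟨hsucc _ hs, ⟨q, rfl⟩⟩,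
        lt_iff.2 (Or.inr ⟨rfl, hq⟩), lt_iff.2 (Or.inl h)⟩
    · simp only [HasCycSucc, not_exists, not_and, not_forall, not_not] at hs
      obtain ⟨w, hw⟩ := hs b.pt h.ne'
      obtain ⟨d, hd, hd'⟩ := hdense _ _ _ hw
      have : a.pt < d ∧ d < b.pt := by unfold CycLT at hd'; grind
      exact ⟨of d, ⟨hd, ⟨0, Rat.cast_zero⟩⟩, lt_iff.2 (Or.inl this.1), lt_iff.2 (Or.inl this.2)⟩
  · obtain ⟨q, hq, hq'⟩ := exists_rat_btwn hlt
    have hs : HasCycSucc a.pt := h ▸ hasCycSucc (a.ht_nonneg.trans_lt hlt)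
    exact ⟨⟨a.pt, q, Or.inr ⟨a.ht_nonneg.trans_lt hq, hs⟩⟩, ⟨hsucc _ hs, ⟨q, rfl⟩⟩,
      lt_iff.2 (Or.inr ⟨rfl, hq⟩), lt_iff.2 (Or.inr ⟨h, hq'⟩)⟩

/-- Arcs of the filled order have open preimages in the original order. -/
theorem isOpen_setOf_cycLT_of [TopologicalSpace X] [T1Space X]
    (hopen : ∀ a b : X, a ≠ b → IsOpen {x | CycLT a x b}) (z w : FilledGaps X) (hzw : z ≠ w) :
    IsOpen {x | CycLT z (of x) w} := by
  have hz := z.ht_nonneg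
  have hw := w.ht_nonneg
  have h0 : ∀ x : X, (of x).pt = x ∧ (of x).ht = 0 := fun x => ⟨rfl, rfl⟩
  rcases hw.eq_or_lt with ht | ht
  · by_cases hpt : z.pt = w.pt
    · have hzpos : 0 < z.ht := hz.lt_of_ne fun h => hzw (FilledGaps.ext hpt (h.symm.trans ht))
      convert! isOpen_compl_singleton (x := z.pt) using 1
      ext x
      simp only [Set.mem_ofPred_eq, Set.mem_compl_iff, Set.mem_singleton_iff, CycLT, lt_iff, h0]
      grind
    · convert! hopen _ _ hpt using 1
      ext x
      simp only [Set.mem_ofPred_eq, CycLT, lt_iff, h0]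
      grind
  · obtain ⟨y, hy, hyw⟩ := hasCycSucc ht
    by_cases hpt : z.pt = w.pt
    · rcases lt_trichotomy z.ht w.ht with h | h | h
      · convert isOpen_empty
        ext x
        simp only [Set.mem_ofPred_eq, CycLT, lt_iff, h0, Set.mem_empty_iff_false]
        grind
      · exact absurd (FilledGaps.ext hpt h) hzw
      · convert isOpen_univ
        ext x
        simp only [Set.mem_ofPred_eq, CycLT, lt_iff, h0, Set.mem_univ]
        grind
    · unfold CycLT at hyw
      by_cases hzy : z.pt = y
      · convert! isOpen_compl_singleton (x := z.pt) using 1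
        ext x
        have := hyw x
        simp only [Set.mem_ofPred_eq, Set.mem_compl_iff, Set.mem_singleton_iff, CycLT,
          lt_iff, h0]
        grind
      · convert! hopen _ _ hzy using 1
        ext x
        have := hyw x
        have := hyw z.pt
        simp only [Set.mem_ofPred_eq, CycLT, lt_iff, h0]
        grind

end LinearOrder

variable {X : Type*} [LinearOrder X] [OrderBot X]

noncomputable instance : OrderBot (FilledGaps X) where
  bot := of ⊥
  bot_le z := by
    rw [le_iff]
    rcases eq_or_ne z.pt ⊥ with h | h
    · exact Or.inr ⟨h.symm, z.ht_nonneg⟩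
    · exact Or.inl (bot_lt_iff_ne_bot.2 h)

instance [Nontrivial X] : NoMaxOrder (FilledGaps X) where
  exists_gt z := by
    by_cases h : HasCycSucc z.pt
    · exact ⟨⟨z.pt, z.ht + 1, Or.inr ⟨by linarith [z.ht_nonneg], h⟩⟩,
        lt_iff.2 (Or.inr ⟨rfl, lt_add_one _⟩)⟩
    · suffices ∃ w, z.pt < w from this.imp' of fun w hw => lt_iff.2 (Or.inl hw)
      rcases eq_or_ne z.pt ⊥ with hz | hz
      · obtain ⟨w, hw⟩ := exists_ne (⊥ : X)
        exact ⟨w, hz ▸ bot_lt_iff_ne_bot.2 hw⟩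
      · simp only [HasCycSucc, not_exists, not_and, not_forall, not_not] at h
        obtain ⟨w, hw⟩ := h ⊥ hz.symm
        refine ⟨w, ?_⟩
        unfold CycLT at hw
        have := not_lt_bot (a := w)
        grind

end FilledGaps

section CyclicTopology

variable {X : Type*} [LinearOrder X] [TopologicalSpace X]

theorem exists_isLUB_of_isOpen_setOf_cycLT [CompactSpace X]
    (hopen : ∀ a b : X, a ≠ b → IsOpen {x | CycLT a x b}) {S : Set X} (hne : S.Nonempty)
    (hb : BddAbove S) : ∃ x, IsLUB S x := by
  by_contra! hlub
  obtain ⟨s₀, hs₀⟩ := hne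
  obtain ⟨u₀, hu₀⟩ := hb
  have hlt : ∀ u ∈ upperBounds S, ∀ s ∈ S, s < u := fun u hu s hs =>
    (hu hs).lt_of_ne fun h => hlub u ⟨hu, fun v hv => h ▸ hv hs⟩
  have hS : ∀ s ∈ S, ∃ t ∈ S, s < t := by
    intro s hs
    by_contra! h
    exact hlub s ⟨h, fun v hv => hv hs⟩
  have hU : ∀ u ∈ upperBounds S, ∃ v ∈ upperBounds S, v < u := by
    intro u hu
    by_contra! h
    exact hlub u ⟨hu, h⟩
  have : Nonempty (upperBounds S ×ˢ S : Set (X × X)) := ⟨⟨(u₀, s₀), hu₀, hs₀⟩⟩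
  let arc : (upperBounds S ×ˢ S : Set (X × X)) → Set X := fun p => {x | CycLT p.1.1 x p.1.2}
  have hcov : Set.univ ⊆ ⋃ p, arc p := fun x _ => by
    rw [Set.mem_iUnion]
    by_cases hx : x ∈ upperBounds S
    · obtain ⟨v, hv, hvx⟩ := hU x hx
      exact ⟨⟨(v, s₀), hv, hs₀⟩, Or.inr (Or.inr ⟨hlt v hv s₀ hs₀, hvx⟩)⟩
    · simp only [upperBounds, Set.mem_ofPred_eq, not_forall, not_le] at hx
      obtain ⟨s, hs, hxs⟩ := hx
      exact ⟨⟨(u₀, s), hu₀, hs⟩, Or.inr (Or.inl ⟨hxs, hlt u₀ hu₀ s hs⟩)⟩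
  have hdir : Directed (· ⊆ ·) arc := by
    rintro ⟨⟨u, s⟩, hu, hs⟩ ⟨⟨v, t⟩, hv, ht⟩
    have huv : min u v ∈ upperBounds S := by rcases min_choice u v with h | h <;> rwa [h]
    have hst : max s t ∈ S := by rcases max_choice s t with h | h <;> rwa [h]
    have h1 := hlt _ hu _ hs
    have h2 := hlt _ hv _ ht
    have h3 := hlt _ huv _ hst
    refine ⟨⟨(min u v, max s t), huv, hst⟩, fun x hx => ?_, fun x hx => ?_⟩ <;>
    · simp only [arc, Set.mem_ofPred_eq, CycLT] at hx ⊢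
      grind
  obtain ⟨⟨⟨u, s⟩, hu, hs⟩, hsub⟩ := isCompact_univ.elim_directed_cover arc
    (fun p => hopen _ _ (hlt _ p.2.1 _ p.2.2).ne') hcov hdir
  have := hsub (Set.mem_univ s)
  simp only [arc, Set.mem_ofPred_eq, CycLT] at this
  grind

theorem exists_countable_cyc_dense [OrderBot X] [SecondCountableTopology X]
    (hopen : ∀ a b : X, a ≠ b → IsOpen {x | CycLT a x b}) :
    ∃ D : Set X, D.Countable ∧ (∀ a w b, CycLT a w b → ∃ d ∈ D, CycLT a d b) ∧
      ∀ x, HasCycSucc x → x ∈ D := by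
  obtain ⟨Q, hQ, hQd⟩ := TopologicalSpace.exists_countable_dense X
  let B := TopologicalSpace.countableBasis X
  refine ⟨Q ∪ ({⊥} ∪ ⋃ U ∈ B, {x | IsGreatest U x}), ?_, fun a w b h => ?_, ?_⟩
  · refine hQ.union ((Set.countable_singleton _).union ?_)
    refine (TopologicalSpace.countable_countableBasis X).biUnion fun U _ => ?_
    exact Set.Subsingleton.countable fun x hx y hy => hx.unique hy
  · have hab : a ≠ b := by unfold CycLT at h; grind
    obtain ⟨d, hd, hd'⟩ := hQd.exists_mem_open (hopen a b hab) ⟨w, h⟩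
    exact ⟨d, Or.inl hd, hd'⟩
  · rintro x ⟨y, hyx, hxy⟩
    rcases eq_or_ne x ⊥ with rfl | hx
    · exact Or.inr (Or.inl rfl)
    obtain ⟨V, hV, hxV, hmax⟩ : ∃ V : Set X, IsOpen V ∧ x ∈ V ∧ ∀ v ∈ V, v ≤ x := by
      have hb := bot_lt_iff_ne_bot.2 hx
      rcases eq_or_ne y ⊥ with rfl | hy
      · refine ⟨Set.univ, isOpen_univ, trivial, fun v _ => not_lt.1 fun hv => hxy v ?_⟩
        exact Or.inr (Or.inr ⟨hb, hv⟩)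
      · have hy' := bot_lt_iff_ne_bot.2 hy
        have hlt : x < y := by
          have := hxy ⊥
          unfold CycLT at this
          grind
        refine ⟨_, hopen ⊥ y hy.symm, Or.inl ⟨hb, hlt⟩, fun v hv => ?_⟩
        have := hxy v
        have := not_lt_bot (a := v)
        simp only [Set.mem_ofPred_eq, CycLT] at hv this
        unfold CycLT at *
        grind
    obtain ⟨U, hU, hxU, hUV⟩ :=
      (TopologicalSpace.isBasis_countableBasis X).exists_subset_of_mem_open hxV hV
    refine Or.inr (Or.inr (Set.mem_iUnion₂.2 ⟨U, hU, hxU, fun v hv => hmax v (hUV hv)⟩))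

/-- A cyclic order automorphism of a separable compact space extends to a circle homeomorphism. -/
theorem exists_circle_extension [OrderBot X] [CompactSpace X] [SecondCountableTopology X]
    [T2Space X] [Nontrivial X] (hopen : ∀ a b : X, a ≠ b → IsOpen {x | CycLT a x b}) (σ : X ≃ X)
    (hσ : ∀ a b c, CycLT (σ a) (σ b) (σ c) ↔ CycLT a b c) :
    ∃ (ψ : AddCircle (1 : ℝ) ≃ₜ AddCircle (1 : ℝ)) (i : X → AddCircle (1 : ℝ))
      (p : AddCircle (1 : ℝ) → X), Topology.IsEmbedding i ∧ (∀ x, i (σ x) = ψ (i x)) ∧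
      ∀ y, p (ψ y) = σ (p y) := by
  obtain ⟨D, hD, hdense, hsucc⟩ := exists_countable_cyc_dense hopen
  obtain ⟨E, hE, hEd⟩ := FilledGaps.exists_countable_dense hD hdense hsucc
  obtain ⟨h, hmono, hrange⟩ := exists_strictMono_range_eq_Ico hE hEd fun S hS hb =>
    FilledGaps.exists_isLUB (fun T => exists_isLUB_of_isOpen_setOf_cycLT hopen) hS hb
  have hmem : ∀ z, h z ∈ Set.Ico (0 : ℝ) 1 := fun z => hrange ▸ Set.mem_range_self z
  have hrep : ∀ z, circleRep (h z : AddCircle (1 : ℝ)) = h z := fun z =>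
    circleRep_coe (hmem z).1 (hmem z).2
  have hbij : Function.Bijective fun z => (h z : AddCircle (1 : ℝ)) := by
    refine ⟨fun z w hzw => hmono.injective ?_, fun y => ?_⟩
    · rw [← hrep z, ← hrep w]
      exact congrArg circleRep hzw
    · obtain ⟨z, hz⟩ : circleRep y ∈ Set.range h :=
        hrange ▸ ⟨circleRep_nonneg y, circleRep_lt_one y⟩
      exact ⟨z, by simp only [hz, coe_circleRep]⟩
  let Φ : FilledGaps X ≃ AddCircle (1 : ℝ) := Equiv.ofBijective _ hbij
  have hΦ : ∀ z w u, CycLT (circleRep (Φ z)) (circleRep (Φ w)) (circleRep (Φ u)) ↔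
      CycLT z w u := fun z w u => by
    simp only [Φ, Equiv.ofBijective_apply, hrep, cycLT_comp_iff hmono]
  let ψ := (Φ.symm.trans (FilledGaps.congr σ hσ)).trans Φ
  have hψ : ∀ a b c, CycLT (circleRep (ψ a)) (circleRep (ψ b)) (circleRep (ψ c)) ↔
      CycLT (circleRep a) (circleRep b) (circleRep c) := fun a b c => by
    simp only [ψ, Equiv.trans_apply, hΦ, FilledGaps.cycLT_congr_iff]
    rw [← hΦ, Φ.apply_symm_apply, Φ.apply_symm_apply, Φ.apply_symm_apply]
  have hψ' : ∀ a b c, CycLT (circleRep (ψ.symm a)) (circleRep (ψ.symm b))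
      (circleRep (ψ.symm c)) ↔ CycLT (circleRep a) (circleRep b) (circleRep c) :=
    fun a b c => by
      rw [← hψ, ψ.apply_symm_apply, ψ.apply_symm_apply, ψ.apply_symm_apply]
  have : Fact ((0 : ℝ) < 1) := ⟨one_pos⟩
  have hcont : Continuous fun x : X => Φ (FilledGaps.of x) := by
    refine continuous_of_isOpen_setOf_cycLT_circleRep fun a b hab => ?_
    convert! FilledGaps.isOpen_setOf_cycLT_of hopen (Φ.symm a) (Φ.symm b)
      (Φ.symm.injective.ne hab) using 1
    ext x
    rw [Set.mem_ofPred_eq, Set.mem_ofPred_eq, ← hΦ, Φ.apply_symm_apply, Φ.apply_symm_apply]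
  have hof : Function.Injective (FilledGaps.of (X := X)) := fun x y hxy =>
    congrArg FilledGaps.pt hxy
  refine ⟨⟨ψ, continuous_of_cycLT_circleRep_iff hψ, continuous_of_cycLT_circleRep_iff hψ'⟩,
    fun x => Φ (FilledGaps.of x), fun y => (Φ.symm y).pt,
    (hcont.isClosedEmbedding (Φ.injective.comp hof)).isEmbedding, fun x => ?_, fun y => ?_⟩
  · show _ = ψ _
    simp only [ψ, Equiv.trans_apply, Φ.symm_apply_apply]
    rfl
  · show (Φ.symm (ψ y)).pt = _
    simp only [ψ, Equiv.trans_apply, Φ.symm_apply_apply]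
    rfl

end CyclicTopology

theorem zpow_apply_ne_of_forall_dense_orbit {X : Type*} [TopologicalSpace X] [T1Space X]
    [Infinite X] {σ : Equiv.Perm X} (hmin : ∀ x : X, Dense {y : X | ∃ n : ℤ, y = (σ ^ n) x})
    (x : X) {n : ℤ} (hn : n ≠ 0) : (σ ^ n) x ≠ x := by
  intro h
  have hsub : {y : X | ∃ n : ℤ, y = (σ ^ n) x} ⊆ (fun k : ℤ => (σ ^ k) x) '' Set.Icc 0 |n| := by
    rintro _ ⟨k, rfl⟩
    refine ⟨k % n, ⟨Int.emod_nonneg _ hn, (Int.emod_lt_abs _ hn).le⟩, ?_⟩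
    have hk : (σ ^ (n * (k / n))) x = x := by
      rw [zpow_mul]
      exact Equiv.Perm.zpow_apply_eq_self_of_apply_eq_self h _
    conv_rhs => rw [← Int.emod_add_mul_ediv k n, zpow_add, Equiv.Perm.mul_apply, hk]
  have hfin := ((Set.finite_Icc 0 |n|).image fun k : ℤ => (σ ^ k) x).subset hsub
  have := (hmin x).closure_eq
  rw [hfin.isClosed.closure_eq] at this
  exact Set.infinite_univ (this ▸ hfin)

theorem zpow_apply_semiconj {X Y : Type*} {σ : Equiv.Perm X} {ψ : Equiv.Perm Y} {p : Y → X}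
    (hp : ∀ y, p (ψ y) = σ (p y)) (n : ℤ) (y : Y) : p ((ψ ^ n) y) = (σ ^ n) (p y) := by
  induction n generalizing y with
  | zero => rfl
  | succ n ih => rw [zpow_add_one, zpow_add_one, Equiv.Perm.mul_apply, Equiv.Perm.mul_apply, ih, hp]
  | pred n ih =>
    rw [zpow_sub_one, zpow_sub_one, Equiv.Perm.mul_apply, Equiv.Perm.mul_apply, ih,
      Equiv.Perm.eq_inv_iff_eq.2 ((hp (ψ⁻¹ y)).symm.trans (congrArg p (ψ.apply_symm_apply y)))]

/-- A circular order is the cyclic order of a linear order starting at any given point. -/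
theorem CircularOrderRel.exists_linearOrder {X : Type*} (R : CircularOrderRel X) (x₀ : X) :
    ∃ (_ : LinearOrder X) (_ : OrderBot X), ∀ a b c : X, CycLT a b c ↔ R.rel a b c := by
  have hcyc := R.cyclic
  have hasymm := R.asymm
  have htrans := R.trans
  have htotal := R.total
  have hne : ∀ a b c, R.rel a b c → a ≠ b ∧ b ≠ c ∧ a ≠ c := by
    intro a b c h
    refine ⟨?_, ?_, ?_⟩ <;> rintro rfl <;> grind
  let lt : X → X → Prop := fun a b => R.rel x₀ a b ∨ (a = x₀ ∧ b ≠ x₀)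
  have hlt : ∀ a b, lt a b ↔ R.rel x₀ a b ∨ (a = x₀ ∧ b ≠ x₀) := fun _ _ => Iff.rfl
  have hirr : ∀ a, ¬ lt a a := by grind
  have htr : ∀ a b c, lt a b → lt b c → lt a c := by grind
  have htot : ∀ a b, lt a b ∨ a = b ∨ lt b a := by
    intro a b
    have := htotal x₀ a b
    grind
  have : IsStrictTotalOrder X lt :=
    { irrefl := hirr, trans := htr, trichotomous := fun a b h1 h2 => by
        have := htot a b
        tauto }
  classical
  let L : LinearOrder X := linearOrderOfSTO lt
  refine ⟨L, { bot := x₀, bot_le := fun a => ?_ }, fun a b c => ?_⟩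
  · exact not_lt.1 fun h : lt a x₀ => by grind
  · show (lt a b ∧ lt b c) ∨ (lt b c ∧ lt c a) ∨ (lt c a ∧ lt a b) ↔ _
    constructor
    · grind
    · intro h
      have := hne _ _ _ h
      have := htotal x₀ a b
      have := htotal x₀ b c
      have := htotal x₀ a c
      grind

/-- For an infinite minimal cascade `(X,σ)` on a compact
Hausdorff space, the following are equivalent: (1) `X` is second countable
and circularly orderable with `σ` c-order preserving; (2) `(X,σ)` embeds in
a circle homeomorphism `(ℝ/ℤ, ψ)` without periodic points. -/
theorem minimal_cascade_circularly_ordered_iff_embeds_in_circle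
    {X : Type*} [tX : TopologicalSpace X] [CompactSpace X] [T2Space X]
    [Infinite X]
    (σ : X ≃ₜ X)
    (hmin : ∀ x : X, Dense {y : X | ∃ n : ℤ, y = (σ.toEquiv ^ n) x}) :
    (SecondCountableTopology X ∧
      ∃ R : CircularOrderRel X, tX = intervalTopology R.rel ∧
        IsCOP R.rel R.rel (⇑σ)) ↔
    (∃ (ψ : AddCircle (1 : ℝ) ≃ₜ AddCircle (1 : ℝ)) (i : X → AddCircle (1 : ℝ)),
      (∀ (y : AddCircle (1 : ℝ)) (n : ℤ), n ≠ 0 → (ψ.toEquiv ^ n) y ≠ y) ∧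
      Topology.IsEmbedding i ∧
      (∀ x : X, i (σ x) = ψ (i x))) := by
  constructor
  · rintro ⟨_, R, hR, hcop, -⟩
    obtain ⟨x₀⟩ : Nonempty X := inferInstance
    obtain ⟨_, _, hrel⟩ := R.exists_linearOrder x₀
    have hopen : ∀ a b : X, a ≠ b → IsOpen {x | CycLT a x b} := fun a b hab => by
      simp only [hrel]
      rw [hR]
      exact TopologicalSpace.isOpen_generateFrom_of_mem ⟨a, b, hab, rfl⟩
    have himp : ∀ a b c, CycLT a b c → CycLT (σ a) (σ b) (σ c) := fun a b c h => by
      have hne : a ≠ b ∧ b ≠ c ∧ a ≠ c := by unfold CycLT at h; grind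
      rw [hrel] at h ⊢
      exact hcop a b c h (σ.injective.ne hne.1) (σ.injective.ne hne.2.1) (σ.injective.ne hne.2.2)
    have hσ : ∀ a b c, CycLT (σ a) (σ b) (σ c) ↔ CycLT a b c := fun a b c =>
      ⟨fun h => by
        by_contra h'
        have hne : σ a ≠ σ b ∧ σ b ≠ σ c ∧ σ a ≠ σ c := by unfold CycLT at h; grind
        have hab := ne_of_apply_ne σ hne.1
        have hbc := ne_of_apply_ne σ hne.2.1
        have hac := ne_of_apply_ne σ hne.2.2
        have h2 := himp a c b (by unfold CycLT at h' ⊢; grind)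
        rw [hrel] at h h2
        exact R.asymm _ _ _ h h2, himp a b c⟩
    obtain ⟨ψ, i, p, hi, hiσ, hp⟩ := exists_circle_extension hopen σ.toEquiv hσ
    refine ⟨ψ, i, fun y n hn h => ?_, hi, hiσ⟩
    refine zpow_apply_ne_of_forall_dense_orbit hmin (p y) hn ?_
    rw [← zpow_apply_semiconj (ψ := ψ.toEquiv) hp, h]
  · rintro ⟨ψ, i, hψ, hi, hiσ⟩
    refine ⟨hi.secondCountableTopology, _,
      eq_intervalTopology_of_continuous_injective hi.continuous hi.injective, ?_⟩
    refine ⟨fun a b c h _ _ _ => ?_, fun a c h => Or.inl ?_⟩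
    · show CycLT (circleRep (i (σ a))) (circleRep (i (σ b))) (circleRep (i (σ c)))
      rw [hiσ, hiσ, hiσ]
      exact cycLT_circleRep_of_forall_ne ψ (fun y => hψ y 1 one_ne_zero) h
    · obtain rfl := σ.injective h
      rintro x ((rfl | rfl) | hx)
      · rfl
      · rfl
      · change CycLT _ _ _ at hx
        unfold CycLT at hx
        grind
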